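/- Let f : D ⊆ E → F be an analytic map between real Banach spaces and let ζ ∈ D be a nondegenerate zero of f (f(ζ) = 0 and Df(ζ) invertible). Let 0 < u₀ < (5−√17)/4 and assume the open ball B = B(ζ, u₀/γ(f,ζ)) is contained in D. Then for every x₀ ∈ B, the sequences x_{i+1} = N(f, x_i) and u_{i+1} = u_i²/ψ(u_i) are well-defined for all i (each x_i ∈ D with Df(x_i) invertible), and ‖x_i − ζ‖ ≤ (u_i/u₀)·‖x₀ − ζ‖ with u_i/u₀ ≤ (u₀/ψ(u₀))^{2^i − 1} for all i. -/

import Mathlib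

open Filter Metric

/-- The k-th term whose supremum over `k ≥ 2` defines Smale's gamma invariant:
`‖(1/k!) · Df(x)⁻¹ ∘ D^k f(x)‖^(1/(k-1))`, where `dinv` plays the role of `Df(x)⁻¹`. -/
noncomputable def gammaTerm {E F : Type*} [NormedAddCommGroup E] [NormedSpace ℝ E]
    [NormedAddCommGroup F] [NormedSpace ℝ F]
    (f : E → F) (dinv : F →L[ℝ] E) (x : E) (k : ℕ) : ℝ :=
  (‖dinv.compContinuousMultilinearMap (iteratedFDeriv ℝ k f x)‖ / (Nat.factorial k : ℝ)) ^
    ((1 : ℝ) / ((k : ℝ) - 1))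

/-- The set of values `gammaTerm f dinv x k` for `k ≥ 2`. -/
noncomputable def gammaSet {E F : Type*} [NormedAddCommGroup E] [NormedSpace ℝ E]
    [NormedAddCommGroup F] [NormedSpace ℝ F]
    (f : E → F) (dinv : F →L[ℝ] E) (x : E) : Set ℝ :=
  {g : ℝ | ∃ k : ℕ, 2 ≤ k ∧ g = gammaTerm f dinv x k}

/-- Smale's gamma invariant `γ(f,x) = sup_{k ≥ 2} ‖(1/k!)·Df(x)⁻¹ ∘ D^k f(x)‖^(1/(k-1))`. -/
noncomputable def smaleGamma {E F : Type*} [NormedAddCommGroup E] [NormedSpace ℝ E]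
    [NormedAddCommGroup F] [NormedSpace ℝ F]
    (f : E → F) (dinv : F →L[ℝ] E) (x : E) : ℝ :=
  sSup (gammaSet f dinv x)

/-- `ψ(u) = 1 - 4u + 2u²`. -/
def psi (u : ℝ) : ℝ := 1 - 4 * u + 2 * u ^ 2


section Helpers

variable {E : Type*} [NormedAddCommGroup E] [NormedSpace ℝ E]
  {F : Type*} [NormedAddCommGroup F] [NormedSpace ℝ F]

theorem aux_norm_derivSeries_le (p : FormalMultilinearSeries ℝ E F) (n : ℕ) :
    ‖p.derivSeries n‖ ≤ ((n : ℝ) + 1) * ‖p (n + 1)‖ := by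
  have h1 : ‖p.derivSeries n‖ ≤ ‖p.changeOriginSeries 1 n‖ := by
    apply (ContinuousLinearMap.norm_compContinuousMultilinearMap_le _ _).trans
    refine (mul_le_mul_of_nonneg_right (?_ : _ ≤ (1 : ℝ)) (norm_nonneg _)).trans (one_mul _).le
    exact ContinuousLinearMap.opNorm_le_bound _ zero_le_one (fun m => by simp)
  have h2 := p.nnnorm_changeOriginSeries_le_tsum 1 n
  have h3 : (∑' _ : { s : Finset (Fin (1 + n)) // s.card = n }, ‖p (1 + n)‖₊)
      = (n + 1 : NNReal) * ‖p (n + 1)‖₊ := by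
    rw [tsum_fintype, Finset.sum_const, nsmul_eq_mul]
    congr 1
    · rw [Finset.card_univ, Fintype.card_subtype, ← Finset.powerset_univ,
        ← Finset.powersetCard_eq_filter, Finset.card_powersetCard, Finset.card_univ,
        Fintype.card_fin, add_comm, Nat.choose_succ_self_right]
      push_cast; ring
    · rw [add_comm]
  rw [h3] at h2
  exact h1.trans (by exact_mod_cast h2)

theorem aux_norm_iteratedFDeriv_le [CompleteSpace F] {f : E → F} {x : E}
    (hf : AnalyticAt ℝ f x) :
    ∃ C a : ℝ, 1 ≤ C ∧ 1 ≤ a ∧ ∀ n : ℕ,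
      ‖iteratedFDeriv ℝ n f x‖ / (Nat.factorial n : ℝ) ≤ C * a ^ n := by
  obtain ⟨p, r, hp⟩ := hf
  obtain ⟨C, a, hC, ha, h⟩ := p.le_mul_pow_of_radius_pos hp.radius_pos
  refine ⟨max C 1, max a 1, le_max_right _ _, le_max_right _ _, fun n => ?_⟩
  have h1 : ‖iteratedFDeriv ℝ n f x‖ ≤ (Nat.factorial n : ℝ) * ‖p n‖ := by
    refine ContinuousMultilinearMap.opNorm_le_bound (by positivity) fun v => ?_
    rw [hp.iteratedFDeriv_eq_sum_of_completeSpace]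
    refine (norm_sum_le _ _).trans ?_
    have : ∀ σ ∈ (Finset.univ : Finset (Equiv.Perm (Fin n))),
        ‖p n (fun i => v (σ i))‖ ≤ ‖p n‖ * ∏ i, ‖v i‖ := fun σ _ => by
      refine ((p n).le_opNorm _).trans_eq ?_
      rw [Equiv.prod_comp σ (fun i => ‖v i‖)]
    refine (Finset.sum_le_sum this).trans_eq ?_
    simp [Finset.card_univ, Fintype.card_perm, mul_assoc]
  have hfac : (0 : ℝ) < (Nat.factorial n : ℝ) := by positivity
  rw [div_le_iff₀ hfac]
  calc _ ≤ (Nat.factorial n : ℝ) * ‖p n‖ := h1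
    _ ≤ (Nat.factorial n : ℝ) * (C * a ^ n) := by gcongr; exact h n
    _ ≤ (Nat.factorial n : ℝ) * (max C 1 * (max a 1) ^ n) := by
        gcongr
        · exact le_max_left _ _
        · exact le_max_left _ _
    _ = _ := by ring

theorem aux_gamma [CompleteSpace E] [CompleteSpace F] {f : E → F} {x : E} (hf : AnalyticAt ℝ f x)
    (L : F →L[ℝ] E) :
    0 ≤ smaleGamma f L x ∧ ∀ k : ℕ, 2 ≤ k →
      ‖iteratedFDeriv ℝ k (L ∘ f) x‖ / (Nat.factorial k : ℝ) ≤ smaleGamma f L x ^ (k - 1) := by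
  have hg : AnalyticAt ℝ (L ∘ f) x := (L.analyticAt _).comp hf
  have hcomp : ∀ k : ℕ, iteratedFDeriv ℝ k (L ∘ f) x
      = L.compContinuousMultilinearMap (iteratedFDeriv ℝ k f x) := fun k =>
    L.iteratedFDeriv_comp_left (n := (k : WithTop ℕ∞)) hf.contDiffAt le_rfl
  obtain ⟨C, a, hC, ha, h⟩ := aux_norm_iteratedFDeriv_le hg
  have hterm0 : ∀ k, 0 ≤ gammaTerm f L x k := fun k => by unfold gammaTerm; positivity
  have hexp : ∀ k : ℕ, 2 ≤ k → (1 : ℝ) / ((k : ℝ) - 1) = ((k - 1 : ℕ) : ℝ)⁻¹ := fun k hk => by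
    rw [Nat.cast_sub (by omega)]; simp
  have hbdd : BddAbove (gammaSet f L x) := by
    refine ⟨C * a ^ 2, ?_⟩
    rintro _ ⟨k, hk, rfl⟩
    unfold gammaTerm
    rw [hexp k hk, ← hcomp]
    have h1 : ‖iteratedFDeriv ℝ k (L ∘ f) x‖ / (Nat.factorial k : ℝ)
        ≤ (C * a ^ 2) ^ (k - 1) := by
      refine (h k).trans ?_
      rw [mul_pow, ← pow_mul]
      gcongr
      · exact le_self_pow₀ hC (by omega)
      · omega
    refine (Real.rpow_le_rpow (by positivity) h1 (by positivity)).trans_eq ?_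
    exact Real.pow_rpow_inv_natCast (by positivity) (by omega)
  have h0 : 0 ≤ smaleGamma f L x := by
    apply Real.sSup_nonneg
    rintro _ ⟨k, hk, rfl⟩
    exact hterm0 k
  refine ⟨h0, fun k hk => ?_⟩
  have h1 : gammaTerm f L x k ≤ smaleGamma f L x := le_csSup hbdd ⟨k, hk, rfl⟩
  have h2 := pow_le_pow_left₀ (hterm0 k) h1 (k - 1)
  refine le_trans (le_of_eq ?_) h2
  unfold gammaTerm
  rw [hexp k hk, ← hcomp, Real.rpow_inv_natCast_pow (by positivity) (by omega)]

/-- Taylor series of `g` at `ζ` -/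
noncomputable def auxSeries (g : E → F) (ζ : E) : FormalMultilinearSeries ℝ E F :=
  fun n => ((Nat.factorial n : ℝ)⁻¹) • iteratedFDeriv ℝ n g ζ

theorem auxSeries_hasFPowerSeriesOnBall [CompleteSpace E] {g : E → E} {ζ : E} {γ : ℝ}
    {r : NNReal} (hr : 0 < r) (hγ0 : 0 ≤ γ) (hγr : γ * r < 1)
    (hg : AnalyticOnNhd ℝ g (ball ζ r)) (hgζ : g ζ = 0)
    (hdg : fderiv ℝ g ζ = ContinuousLinearMap.id ℝ E)
    (hγ : ∀ k : ℕ, 2 ≤ k →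
      ‖iteratedFDeriv ℝ k g ζ‖ / (Nat.factorial k : ℝ) ≤ γ ^ (k - 1)) :
    (∀ n, ‖auxSeries g ζ (n + 1)‖ ≤ γ ^ n) ∧
    HasFPowerSeriesOnBall g (auxSeries g ζ) ζ r := by
  set q := auxSeries g ζ with hq
  have hqn : ∀ n, ‖q (n + 1)‖ ≤ γ ^ n := by
    intro n
    rcases Nat.eq_zero_or_pos n with rfl | hn
    · rw [pow_zero]
      refine ContinuousMultilinearMap.opNorm_le_bound zero_le_one fun v => ?_
      simp [hq, auxSeries, iteratedFDeriv_one_apply, hdg]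
    · have := hγ (n + 1) (by omega)
      rw [Nat.add_sub_cancel] at this
      refine le_trans (le_of_eq ?_) this
      simp only [hq, auxSeries]
      rw [norm_smul, norm_inv, Real.norm_natCast]
      ring
  have hrad : (r : ENNReal) ≤ q.radius := by
    refine q.le_radius_of_bound r fun n => ?_
    rcases n with _ | n
    · have : q 0 = 0 := by
        ext v
        simp [hq, auxSeries, hgζ]
      simp [this]
    · calc ‖q (n + 1)‖ * (r : ℝ) ^ (n + 1) ≤ γ ^ n * (r : ℝ) ^ (n + 1) := by
            gcongr; exact hqn n
        _ = (γ * r) ^ n * r := by ring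
        _ ≤ 1 * r := by
            gcongr
            exact pow_le_one₀ (by positivity) hγr.le
        _ = r := one_mul _
  refine ⟨hqn, ?_⟩
  have hrE : (0 : ENNReal) < r := by exact_mod_cast hr
  have hs : HasFPowerSeriesOnBall (fun z => q.sum (z - ζ)) q ζ r := by
    have := ((q.hasFPowerSeriesOnBall (hrE.trans_le hrad)).mono hrE hrad).comp_sub ζ
    simpa using this
  refine hs.congr ?_
  have hsa : AnalyticOnNhd ℝ (fun z => q.sum (z - ζ)) (ball ζ r) := by
    have := hs.analyticOnNhd
    rwa [Metric.eball_coe] at this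
  have hζ : ζ ∈ ball ζ (r : ℝ) := mem_ball_self (by exact_mod_cast hr)
  rw [Metric.eball_coe]
  refine hsa.eqOn_of_preconnected_of_eventuallyEq hg (convex_ball ζ r).isPreconnected hζ ?_
  obtain ⟨p, s, hp⟩ := hg ζ hζ
  filter_upwards [Metric.eball_mem_nhds ζ hp.r_pos] with z hz
  have hz' : z - ζ ∈ Metric.eball (0 : E) s := by
    simpa [Metric.mem_eball, edist_eq_enorm_sub] using hz
  have := hp.hasSum_iteratedFDeriv hz'
  rw [add_sub_cancel] at this
  exact this.tsum_eq

theorem aux_newton_g [CompleteSpace E] {g : E → E} {ζ : E} {γ : ℝ}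
    {r : NNReal} (hγ0 : 0 ≤ γ) (hγr : γ * r < 1)
    (hg : AnalyticOnNhd ℝ g (ball ζ r)) (hgζ : g ζ = 0)
    (hdg : fderiv ℝ g ζ = ContinuousLinearMap.id ℝ E)
    (hγ : ∀ k : ℕ, 2 ≤ k →
      ‖iteratedFDeriv ℝ k g ζ‖ / (Nat.factorial k : ℝ) ≤ γ ^ (k - 1))
    (x : E) (hx : ‖x - ζ‖ < r) (hpsi : 0 < psi (‖x - ζ‖ * γ)) :
    ∃ T : E ≃L[ℝ] E, (T : E →L[ℝ] E) = fderiv ℝ g x ∧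
      ‖x - T.symm (g x) - ζ‖ ≤ (‖x - ζ‖ * γ) / psi (‖x - ζ‖ * γ) * ‖x - ζ‖ := by
  have hr : 0 < r := by
    have := (norm_nonneg _).trans_lt hx
    exact_mod_cast this
  obtain ⟨hqn, hps⟩ := auxSeries_hasFPowerSeriesOnBall hr hγ0 hγr hg hgζ hdg hγ
  set q := auxSeries g ζ with hq
  set y := x - ζ with hy
  set v := ‖y‖ * γ with hv
  have hxy : ζ + y = x := by simp [hy]
  have hv0 : 0 ≤ v := by positivity
  have hv1 : v < 1 := by
    refine lt_of_le_of_lt ?_ hγr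
    rw [hv, mul_comm]; gcongr
  have hym : y ∈ Metric.eball (0 : E) r := by
    rw [Metric.eball_coe]; simpa using hx
  have hS := hps.hasSum hym
  have hS' := hps.fderiv.hasSum hym
  rw [hxy] at hS hS'
  have hnv : ‖v‖ < 1 := by rwa [Real.norm_of_nonneg hv0]
  have hgeo := hasSum_coe_mul_geometric_of_norm_lt_one hnv
  have hgeo2 := hasSum_geometric_of_lt_one hv0 hv1
  have h1v : 0 < 1 - v := by linarith
  have hD0 : q.derivSeries 0 (fun _ => y) = ContinuousLinearMap.id ℝ E := by
    rw [hps.fderiv.coeff_zero, hdg]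
  have hT : ‖fderiv ℝ g x - ContinuousLinearMap.id ℝ E‖ ≤ 1 / (1 - v) ^ 2 - 1 := by
    have a1 := (hasSum_nat_add_iff' 1).2 hS'
    have a2 := (hasSum_nat_add_iff' 1).2 (hgeo.add hgeo2)
    simp only [Finset.sum_range_one, hD0] at a1
    refine (a1.norm_le_of_bounded a2 fun n => ?_).trans_eq ?_
    · refine ((q.derivSeries (n + 1)).le_opNorm _).trans ?_
      rw [Finset.prod_const, Finset.card_univ, Fintype.card_fin]
      calc _ ≤ ((((n + 1 : ℕ) : ℝ) + 1) * γ ^ (n + 1)) * ‖y‖ ^ (n + 1) := by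
            gcongr
            refine (aux_norm_derivSeries_le q (n + 1)).trans ?_
            gcongr
            exact hqn _
        _ = _ := by rw [hv, mul_pow]; ring
    · simp
      field_simp
      ring
  have hpe : psi v = 2 * (1 - v) ^ 2 - 1 := by unfold psi; ring
  have hc1 : 1 / (1 - v) ^ 2 - 1 < 1 := by
    have : 1 / (1 - v) ^ 2 < 2 := by
      rw [div_lt_iff₀ (by positivity)]; linarith
    linarith
  have hR : ‖fderiv ℝ g x y - g x‖ ≤ v / (1 - v) ^ 2 * ‖y‖ := by
    have a1 := (hasSum_nat_add_iff' 1).2 hS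
    have hq0 : q 0 (fun _ => y) = 0 := by rw [hps.coeff_zero, hgζ]
    simp only [Finset.sum_range_one, hq0, sub_zero] at a1
    have a2 := (ContinuousLinearMap.apply ℝ E y).hasSum hS'
    simp only [ContinuousLinearMap.apply_apply, FormalMultilinearSeries.derivSeries_apply_diag]
      at a2
    refine (a2.sub a1).norm_le_of_bounded (hgeo.mul_right ‖y‖) fun n => ?_
    rw [succ_nsmul, add_sub_cancel_right, ← Nat.cast_smul_eq_nsmul ℝ, norm_smul,
      Real.norm_natCast]
    have := (q (n + 1)).le_opNorm (fun _ => y)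
    rw [Finset.prod_const, Finset.card_univ, Fintype.card_fin] at this
    calc _ ≤ (n : ℝ) * (γ ^ n * ‖y‖ ^ (n + 1)) := by
          gcongr
          refine this.trans ?_
          gcongr
          exact hqn _
      _ = _ := by rw [hv, mul_pow]; ring
  have hlt : ‖(1 : E →L[ℝ] E) - fderiv ℝ g x‖ < 1 := by
    rw [norm_sub_rev]; exact hT.trans_lt hc1
  set T : E ≃L[ℝ] E := ContinuousLinearEquiv.ofUnit (Units.oneSub _ hlt) with hTdef
  have hTc : (T : E →L[ℝ] E) = fderiv ℝ g x := by
    ext w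
    change ((Units.oneSub _ hlt : (E →L[ℝ] E)ˣ) : E →L[ℝ] E) w = _
    rw [Units.val_oneSub, sub_sub_cancel]
  refine ⟨T, hTc, ?_⟩
  have hw : x - T.symm (g x) - ζ = y - T.symm (g x) := by rw [hy]; abel
  rw [hw]
  set w := y - T.symm (g x) with hwdef
  have hTw : fderiv ℝ g x w = fderiv ℝ g x y - g x := by
    rw [hwdef, map_sub, ← hTc]; simp
  have hlow : ‖w‖ ≤ ‖fderiv ℝ g x w‖ + (1 / (1 - v) ^ 2 - 1) * ‖w‖ := by
    have e : w = fderiv ℝ g x w - (fderiv ℝ g x - ContinuousLinearMap.id ℝ E) w := by simp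
    calc ‖w‖ = ‖fderiv ℝ g x w - (fderiv ℝ g x - ContinuousLinearMap.id ℝ E) w‖ := by rw [← e]
      _ ≤ _ := norm_sub_le _ _
      _ ≤ _ := by
        gcongr
        exact ContinuousLinearMap.le_of_opNorm_le _ hT w
  rw [hTw] at hlow
  have h3 : (2 - 1 / (1 - v) ^ 2) * ‖w‖ ≤ v / (1 - v) ^ 2 * ‖y‖ := by linarith
  have h4 : (2 - 1 / (1 - v) ^ 2) = psi v / (1 - v) ^ 2 := by rw [hpe]; field_simp
  rw [h4, div_mul_eq_mul_div, div_mul_eq_mul_div, div_le_div_iff_of_pos_right (by positivity)] at h3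
  rw [div_mul_eq_mul_div, le_div_iff₀ hpsi]
  linarith

theorem aux_psi {u : ℝ} (h : u < (5 - Real.sqrt 17) / 4) : u < 1 / 4 ∧ u < psi u := by
  have h17 : Real.sqrt 17 ^ 2 = 17 := Real.sq_sqrt (by norm_num)
  have h4 : 4 < Real.sqrt 17 := by
    rw [Real.lt_sqrt (by norm_num)]; norm_num
  refine ⟨by linarith, ?_⟩
  unfold psi
  nlinarith

theorem aux_psi_anti {a b : ℝ} (ha : a ≤ b) (hb : b < 1 / 4) : psi b ≤ psi a := by
  unfold psi
  nlinarith

theorem aux_newton [CompleteSpace E] [CompleteSpace F]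
    (D : Set E) (f : E → F) (hf : AnalyticOnNhd ℝ f D)
    (ζ : E) (hζ : ζ ∈ D) (hfζ : f ζ = 0)
    (A : E ≃L[ℝ] F) (hA : (A : E →L[ℝ] F) = fderiv ℝ f ζ)
    (u : ℝ) (hu : u < 1 / 4) (hpsi : 0 < psi u)
    (hball : ∀ x : E, ‖x - ζ‖ * smaleGamma f (A.symm : F →L[ℝ] E) ζ < u → x ∈ D)
    (x : E) (hx : ‖x - ζ‖ * smaleGamma f (A.symm : F →L[ℝ] E) ζ < u) :
    ∃ T : E ≃L[ℝ] F, (T : E →L[ℝ] F) = fderiv ℝ f x ∧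
      ‖x - T.symm (f x) - ζ‖ ≤ (‖x - ζ‖ * smaleGamma f (A.symm : F →L[ℝ] E) ζ) /
        psi (‖x - ζ‖ * smaleGamma f (A.symm : F →L[ℝ] E) ζ) * ‖x - ζ‖ := by
  obtain ⟨hγ0, hγ⟩ := aux_gamma (hf ζ hζ) (A.symm : F →L[ℝ] E)
  set γ := smaleGamma f (A.symm : F →L[ℝ] E) ζ with hγdef
  obtain ⟨r, hxr, hru⟩ : ∃ r : ℝ, ‖x - ζ‖ < r ∧ r * γ < u := by
    have hc : Filter.Tendsto (fun r : ℝ => r * γ) (nhdsWithin ‖x - ζ‖ (Set.Ioi ‖x - ζ‖))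
        (nhds (‖x - ζ‖ * γ)) := by
      refine Filter.Tendsto.mono_left ?_ nhdsWithin_le_nhds
      exact (continuous_id.mul continuous_const).tendsto _
    have := ((hc.eventually (gt_mem_nhds hx)).and self_mem_nhdsWithin).exists
    obtain ⟨r, h1, h2⟩ := this
    exact ⟨r, h2, h1⟩
  have hr0 : 0 ≤ r := (norm_nonneg _).trans hxr.le
  lift r to NNReal using hr0
  have hsub : ball ζ (r : ℝ) ⊆ D := fun z hz => hball z (by
    refine lt_of_le_of_lt ?_ hru
    gcongr
    rw [mem_ball, dist_eq_norm] at hz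
    exact hz.le)
  have hg : AnalyticOnNhd ℝ ((A.symm : F →L[ℝ] E) ∘ f) (ball ζ r) := fun z hz =>
    ((A.symm : F →L[ℝ] E).analyticAt _).comp (hf z (hsub hz))
  have hder : ∀ z ∈ D, fderiv ℝ ((A.symm : F →L[ℝ] E) ∘ f) z
      = (A.symm : F →L[ℝ] E).comp (fderiv ℝ f z) := fun z hz =>
    ((A.symm : F →L[ℝ] E).hasFDerivAt.comp z (hf z hz).differentiableAt.hasFDerivAt).fderiv
  have hdg : fderiv ℝ ((A.symm : F →L[ℝ] E) ∘ f) ζ = ContinuousLinearMap.id ℝ E := by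
    rw [hder ζ hζ, ← hA]; ext w; simp
  have hxD : x ∈ D := hball x hx
  have hp : 0 < psi (‖x - ζ‖ * γ) := hpsi.trans_le (aux_psi_anti hx.le hu)
  obtain ⟨T, hT, hN⟩ := aux_newton_g (γ := γ) (r := r) hγ0 (by linarith) hg (by simp [hfζ]) hdg hγ x
    hxr hp
  refine ⟨T.trans A, ?_, ?_⟩
  · ext w
    have := congrArg (fun L : E →L[ℝ] E => A (L w)) (hT.trans (hder x hxD))
    refine Eq.trans this ?_
    exact A.apply_symm_apply _
  · simpa using hN

end Helpers

/-- sharp gamma theorem: let `ζ` be a nondegenerate zero of the analytic map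
`f`, let `0 < u₀ < (5-√17)/4`, and suppose the ball `B(ζ, u₀/γ(f,ζ))` lies in `D`
(multiplicative form).  Then for every `x₀` in that ball the Newton sequence and the
sequence `u_{i+1} = u_i²/ψ(u_i)` are well-defined, with
`‖x_i - ζ‖ ≤ (u_i/u₀)·‖x₀ - ζ‖` and `u_i/u₀ ≤ (u₀/ψ(u₀))^(2^i - 1)`. -/
theorem stmt7 {E F : Type*} [NormedAddCommGroup E] [NormedSpace ℝ E] [CompleteSpace E]
    [NormedAddCommGroup F] [NormedSpace ℝ F] [CompleteSpace F]
    (D : Set E) (hD : IsOpen D) (f : E → F) (hf : AnalyticOnNhd ℝ f D)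
    (ζ : E) (hζ : ζ ∈ D) (hfζ : f ζ = 0)
    (A : E ≃L[ℝ] F) (hA : (A : E →L[ℝ] F) = fderiv ℝ f ζ)
    (u : ℕ → ℝ) (hu0pos : 0 < u 0) (hu0lt : u 0 < (5 - Real.sqrt 17) / 4)
    (hurec : ∀ i, u (i + 1) = u i ^ 2 / psi (u i))
    (hball : ∀ x : E, ‖x - ζ‖ * smaleGamma f (A.symm : F →L[ℝ] E) ζ < u 0 → x ∈ D) :
    ∀ x₀ : E, ‖x₀ - ζ‖ * smaleGamma f (A.symm : F →L[ℝ] E) ζ < u 0 →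
      ∃ (xs : ℕ → E) (As : ℕ → E ≃L[ℝ] F), xs 0 = x₀ ∧
        (∀ i : ℕ, 0 < psi (u i)) ∧
        ∀ i : ℕ, xs i ∈ D ∧ ((As i : E →L[ℝ] F) = fderiv ℝ f (xs i)) ∧
          xs (i + 1) = xs i - (As i).symm (f (xs i)) ∧
          ‖xs i - ζ‖ ≤ u i / u 0 * ‖x₀ - ζ‖ ∧
          u i / u 0 ≤ (u 0 / psi (u 0)) ^ (2 ^ i - 1) := by
  intro x₀ hx₀
  obtain ⟨hu4, hupsi⟩ := aux_psi hu0lt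
  have hpsi0 : 0 < psi (u 0) := hu0pos.trans hupsi
  have hγ0 := (aux_gamma (hf ζ hζ) (A.symm : F →L[ℝ] E)).1
  have key := aux_newton D f hf ζ hζ hfζ A hA (u 0) hu4 hpsi0 hball
  set γ := smaleGamma f (A.symm : F →L[ℝ] E) ζ with hγdef
  have key' : ∀ x : E, ∃ T : E ≃L[ℝ] F, ‖x - ζ‖ * γ < u 0 → (T : E →L[ℝ] F) = fderiv ℝ f x ∧
      ‖x - T.symm (f x) - ζ‖ ≤ (‖x - ζ‖ * γ) / psi (‖x - ζ‖ * γ) * ‖x - ζ‖ := by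
    intro x
    by_cases hx : ‖x - ζ‖ * γ < u 0
    · obtain ⟨T, hT⟩ := key x hx
      exact ⟨T, fun _ => hT⟩
    · exact ⟨A, fun h => absurd h hx⟩
  choose T hT using key'
  have hq0 : 0 < u 0 / psi (u 0) := by positivity
  have hq1 : u 0 / psi (u 0) ≤ 1 := by rw [div_le_one hpsi0]; exact hupsi.le
  have hu : ∀ i, 0 < u i ∧ u i ≤ u 0 := by
    intro i
    induction i with
    | zero => exact ⟨hu0pos, le_rfl⟩
    | succ i ih =>
      obtain ⟨h1, h2⟩ := ih
      have hp : psi (u 0) ≤ psi (u i) := aux_psi_anti h2 hu4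
      have hp0 : 0 < psi (u i) := hpsi0.trans_le hp
      rw [hurec]
      refine ⟨by positivity, ?_⟩
      rw [div_le_iff₀ hp0]
      nlinarith
  have hp : ∀ i, psi (u 0) ≤ psi (u i) := fun i => aux_psi_anti (hu i).2 hu4
  have hp0 : ∀ i, 0 < psi (u i) := fun i => hpsi0.trans_le (hp i)
  have hrate : ∀ i, u i / u 0 ≤ (u 0 / psi (u 0)) ^ (2 ^ i - 1) := by
    intro i
    induction i with
    | zero => simp [hu0pos.ne']
    | succ i ih =>
      have hui := (hu i).1
      have e : 2 ^ (i + 1) - 1 = (2 ^ i - 1) * 2 + 1 := by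
        have := Nat.one_le_two_pow (n := i)
        rw [pow_succ]; omega
      rw [e, pow_succ, pow_mul, hurec]
      calc u i ^ 2 / psi (u i) / u 0 ≤ u i ^ 2 / psi (u 0) / u 0 := by
            gcongr
            exact hp i
        _ = (u i / u 0) ^ 2 * (u 0 / psi (u 0)) := by field_simp
        _ ≤ _ := by gcongr
  let xs : ℕ → E := fun n => Nat.rec x₀ (fun _ x => x - (T x).symm (f x)) n
  have hxs : ∀ i, xs (i + 1) = xs i - (T (xs i)).symm (f (xs i)) := fun i => rfl
  have hle : ∀ i, u i / u 0 ≤ 1 := fun i => by rw [div_le_one hu0pos]; exact (hu i).2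
  have hsmall : ∀ i, ‖xs i - ζ‖ ≤ u i / u 0 * ‖x₀ - ζ‖ →
      ‖xs i - ζ‖ * γ < u 0 ∧ ‖xs i - ζ‖ * γ ≤ u i := by
    intro i hi
    have hui := (hu i).1
    have h1 : ‖xs i - ζ‖ * γ ≤ u i / u 0 * (‖x₀ - ζ‖ * γ) := by
      rw [← mul_assoc]; gcongr
    constructor
    · refine (h1.trans ?_).trans_lt hx₀
      exact mul_le_of_le_one_left (by positivity) (hle i)
    · refine h1.trans ?_
      calc u i / u 0 * (‖x₀ - ζ‖ * γ) ≤ u i / u 0 * u 0 := by gcongr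
        _ = u i := by field_simp
  have hb : ∀ i, ‖xs i - ζ‖ ≤ u i / u 0 * ‖x₀ - ζ‖ := by
    intro i
    induction i with
    | zero =>
      rw [div_self hu0pos.ne', one_mul]
      exact le_rfl
    | succ i ih =>
      obtain ⟨h1, h2⟩ := hsmall i ih
      have hui := (hu i).1
      have h3 := (hT _ h1).2
      rw [hxs, hurec]
      have h4 : psi (u i) ≤ psi (‖xs i - ζ‖ * γ) :=
        aux_psi_anti h2 ((hu i).2.trans_lt hu4)
      have h5 := hp0 i
      calc _ ≤ _ := h3
        _ ≤ u i / psi (u i) * (u i / u 0 * ‖x₀ - ζ‖) := by gcongr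
        _ = _ := by ring
  refine ⟨xs, fun i => T (xs i), rfl, hp0, fun i => ?_⟩
  have h1 := (hsmall i (hb i)).1
  exact ⟨hball _ h1, (hT _ h1).1, hxs i, hb i, hrate i⟩
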